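/- Let x̄ be a local minimum of problem (P), where f is α-strongly convex and L-smooth with 0 < α < L and Assumption 2 holds. Then there exist r_diff > 0, a constant L̃ ≥ 0, and a map Π : E → E such that: (i) for every y ∈ B(x̄, r_diff), Π(y) is the unique nearest point of y in X, i.e., Π(y) ∈ X, ‖y − Π(y)‖ = infDist(y, X), and every p ∈ X with ‖y − p‖ = infDist(y, X) equals Π(y); (ii) Π is L̃-Lipschitz on B(x̄, r_diff); and (iii) for every μ > 0 and every y ∈ B(x̄, r_diff), the Moreau envelope w ↦ d(w)²/(2μ) of the indicator of X is differentiable at y with gradient (1/μ)·(y − Π(y)). -/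

import Mathlib

open Filter Topology Metric
open scoped InnerProductSpace

/-- A nearest-point selection of a closed set is continuous at every point whose nearest point is
unique. -/
theorem continuousAt_nearestPoint {E : Type*} [NormedAddCommGroup E] [ProperSpace E]
    {X : Set E} (hX : IsClosed X) {P : E → E} (hPX : ∀ w, P w ∈ X)
    (hP : ∀ w, ‖w - P w‖ = infDist w X) {y : E}
    (huniq : ∀ p ∈ X, ‖y - p‖ = infDist y X → p = P y) : ContinuousAt P y := by
  have hev : ∀ᶠ w in 𝓝 y, P w ∈ closedBall y (infDist y X + 1 + 1) := by
    have h1 : ∀ᶠ w in 𝓝 y, infDist w X < infDist y X + 1 :=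
      (continuous_infDist_pt X).continuousAt.eventually_lt continuousAt_const (by simp)
    filter_upwards [h1, ball_mem_nhds y one_pos] with w hw hwy
    have h2 := dist_triangle (P w) w y
    have h3 : dist (P w) w = infDist w X := by rw [← hP, dist_comm, dist_eq_norm]
    simp only [mem_ball, mem_closedBall] at *
    linarith
  refine (isCompact_closedBall y _).tendsto_nhds_of_unique_mapClusterPt hev fun x _ hx => ?_
  obtain ⟨U, hU, hUx⟩ := mapClusterPt_iff_ultrafilter.1 hx
  refine huniq x (hX.mem_of_tendsto hUx (Eventually.of_forall hPX)) ?_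
  have hid : Tendsto (fun w : E => w) U (𝓝 y) := hU
  refine tendsto_nhds_unique ((hid.sub hUx).norm) ?_
  simp only [hP]
  exact (continuous_infDist_pt X).continuousAt.tendsto.comp hid

theorem infDist_sq_le {E : Type*} [SeminormedAddCommGroup E] {X : Set E} {p : E} (hp : p ∈ X)
    (w : E) : infDist w X ^ 2 ≤ ‖w - p‖ ^ 2 := by
  have := infDist_le_dist_of_mem (x := w) hp
  rw [dist_eq_norm] at this
  exact pow_le_pow_left₀ infDist_nonneg this 2

section

variable {E : Type*} [NormedAddCommGroup E] [InnerProductSpace ℝ E]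

theorem infDist_sq_sub_le {X : Set E} {y p : E} (hp : p ∈ X) (hyp : ‖y - p‖ = infDist y X)
    (w : E) :
    infDist w X ^ 2 - infDist y X ^ 2 ≤ 2 * ⟪y - p, w - y⟫_ℝ + ‖w - y‖ ^ 2 := by
  have h := infDist_sq_le hp w
  have h2 := norm_add_sq_real (y - p) (w - y)
  rw [show y - p + (w - y) = w - p by abel, hyp] at h2
  linarith

theorem hasGradientAt_infDist_sq [CompleteSpace E] {X : Set E} {P : E → E} (hPX : ∀ w, P w ∈ X)
    (hP : ∀ w, ‖w - P w‖ = infDist w X) {y : E} (hc : ContinuousAt P y) :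
    HasGradientAt (fun w => infDist w X ^ 2) ((2 : ℝ) • (y - P y)) y := by
  rw [hasGradientAt_iff_isLittleO, Asymptotics.isLittleO_iff]
  intro c hc0
  have h1 : ∀ᶠ w in 𝓝 y, ‖P w - P y‖ < c / 4 := by
    have := hc.eventually (ball_mem_nhds (P y) (show 0 < c / 4 by positivity))
    simpa [dist_eq_norm] using this
  have h2 : ∀ᶠ w in 𝓝 y, ‖w - y‖ < c / 4 := by
    have := ball_mem_nhds y (show 0 < c / 4 by positivity)
    filter_upwards [this] with w hw
    simpa [dist_eq_norm] using hw
  filter_upwards [h1, h2] with w hw1 hw2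
  have hu := infDist_sq_sub_le (hPX y) (hP y) w
  have hl := infDist_sq_sub_le (hPX w) (hP w) y
  have e : ⟪w - P w, y - w⟫_ℝ = -⟪y - P y, w - y⟫_ℝ - ‖w - y‖ ^ 2 + ⟪P w - P y, w - y⟫_ℝ := by
    rw [← real_inner_self_eq_norm_sq]
    simp only [inner_sub_left, inner_sub_right]
    ring
  have hcs := real_inner_le_norm (P w - P y) (w - y)
  rw [e, norm_sub_rev y w] at hl
  rw [inner_smul_left, Real.norm_eq_abs, abs_le]
  have hn := norm_nonneg (w - y)
  simp only [conj_trivial]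
  constructor <;> nlinarith

/-- If all points of a closed ball around `y` have a unique nearest point in `X`, then the distance
to `X` grows with slope one from `y` up to the boundary of the ball. -/
theorem exists_infDist_eq_add [ProperSpace E] {X : Set E} (hX : IsClosed X) {P : E → E}
    (hPX : ∀ w, P w ∈ X) (hP : ∀ w, ‖w - P w‖ = infDist w X) {y : E} {T : ℝ} (hT : 0 ≤ T)
    (huniq : ∀ w ∈ closedBall y T, ∀ p ∈ X, ‖w - p‖ = infDist w X → p = P w)
    (hy : 0 < infDist y X) :
    ∃ z, ‖z - y‖ ≤ T ∧ infDist y X + T ≤ infDist z X := by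
  have hcont := continuous_infDist_pt X
  have hcomp := isCompact_closedBall y T
  have hne : (closedBall y T).Nonempty := nonempty_closedBall.2 hT
  have key : ∀ c : ℝ, 0 < c → c < 1 →
      ∃ z ∈ closedBall y T, infDist y X + c * T ≤ infDist z X := by
    intro c hc0 hc1
    obtain ⟨z, hz, hmax⟩ := hcomp.exists_isMaxOn hne
      (f := fun w => infDist w X - c * ‖w - y‖) (by fun_prop)
    have hzy : ‖z - y‖ ≤ T := by simpa [dist_eq_norm] using hz
    have h0 := hmax (mem_closedBall_self hT)
    simp only [Set.mem_ofPred_eq, sub_self, norm_zero, mul_zero, sub_zero] at h0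
    refine ⟨z, hz, ?_⟩
    rcases hzy.eq_or_lt with h | hlt
    · rw [h] at h0; linarith
    exfalso
    have hd : 0 < infDist z X := by
      have := mul_nonneg hc0.le (norm_nonneg (z - y)); linarith
    set D := infDist z X with hD
    set n := (1 / D) • (z - P z) with hn
    have hn1 : ‖n‖ = 1 := by
      rw [hn, norm_smul, hP z, ← hD, Real.norm_of_nonneg (by positivity)]
      field_simp
    have hnz : ⟪n, z - P z⟫_ℝ = D := by
      rw [hn, real_inner_smul_left, real_inner_self_eq_norm_sq, hP z, ← hD]
      field_simp
    have hcP := continuousAt_nearestPoint hX hPX hP (huniq z hz)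
    have hline : Tendsto (fun h : ℝ => z + h • n) (𝓝[>] 0) (𝓝 z) := by
      have : Continuous fun h : ℝ => z + h • n := by fun_prop
      have := this.tendsto 0
      simp only [zero_smul, add_zero] at this
      exact this.mono_left nhdsWithin_le_nhds
    have hlim : Tendsto (fun h : ℝ => 2 * ⟪n, z - P (z + h • n)⟫_ℝ) (𝓝[>] 0) (𝓝 (2 * D)) := by
      rw [← hnz]
      exact (tendsto_const_nhds.inner
        (tendsto_const_nhds.sub (hcP.tendsto.comp hline))).const_mul 2
    have hlim2 : Tendsto (fun h : ℝ => 2 * D * c + c ^ 2 * h) (𝓝[>] 0) (𝓝 (2 * D * c)) := by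
      have : Continuous fun h : ℝ => 2 * D * c + c ^ 2 * h := by fun_prop
      have := this.tendsto 0
      simp only [mul_zero, add_zero] at this
      exact this.mono_left nhdsWithin_le_nhds
    have hle : 2 * D ≤ 2 * D * c := by
      refine le_of_tendsto_of_tendsto hlim hlim2 ?_
      have hsmall : ∀ᶠ h : ℝ in 𝓝[>] 0, h < T - ‖z - y‖ :=
        (eventually_lt_nhds (sub_pos.2 hlt)).filter_mono nhdsWithin_le_nhds
      filter_upwards [hsmall, self_mem_nhdsWithin] with h hh hpos
      have hpos : 0 < h := hpos
      have htri : ‖z + h • n - y‖ ≤ ‖z - y‖ + h := by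
        have := norm_add_le (z - y) (h • n)
        rwa [norm_smul, hn1, mul_one, Real.norm_of_nonneg hpos.le,
          show z - y + h • n = z + h • n - y by abel] at this
      have hmem : z + h • n ∈ closedBall y T := by
        rw [mem_closedBall, dist_eq_norm]; linarith
      have hm := hmax hmem
      simp only [Set.mem_ofPred_eq] at hm
      have hk : infDist (z + h • n) X ≤ D + c * h := by nlinarith
      have hk2 := pow_le_pow_left₀ infDist_nonneg hk 2
      have hl := infDist_sq_sub_le (hPX (z + h • n)) (hP (z + h • n)) z
      have e : z - (z + h • n) = -(h • n) := by abel
      have e2 : ⟪z + h • n - P (z + h • n), -(h • n)⟫_ℝ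
          = -h * ⟪n, z - P (z + h • n)⟫_ℝ - h ^ 2 := by
        rw [add_sub_right_comm, inner_neg_right, inner_add_left, real_inner_smul_right,
          real_inner_self_eq_norm_sq, norm_smul, hn1, real_inner_comm]
        simp; ring
      rw [e, e2, norm_neg, norm_smul, hn1, mul_one, Real.norm_of_nonneg hpos.le, ← hD] at hl
      have : h * (2 * ⟪n, z - P (z + h • n)⟫_ℝ) ≤ h * (2 * D * c + c ^ 2 * h) := by nlinarith
      exact le_of_mul_le_mul_left this hpos
    nlinarith
  obtain ⟨z, hz, hmax⟩ := hcomp.exists_isMaxOn hne hcont.continuousOn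
  refine ⟨z, by simpa [dist_eq_norm] using hz, ?_⟩
  have hlim : Tendsto (fun c : ℝ => infDist y X + c * T) (𝓝[<] 1) (𝓝 (infDist y X + 1 * T)) :=
    (Continuous.tendsto (by fun_prop) 1).mono_left nhdsWithin_le_nhds
  rw [one_mul] at hlim
  refine le_of_tendsto hlim ?_
  filter_upwards [self_mem_nhdsWithin,
    (eventually_gt_nhds (zero_lt_one (α := ℝ))).filter_mono nhdsWithin_le_nhds] with c h1 h0
  obtain ⟨w, hw, hle⟩ := key c h0 h1
  exact hle.trans (hmax hw)

/-- The quantitative normal inequality satisfied by a nearest point `p` of `y` when the distance to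
`X` can be increased with slope one beyond `y`. -/
theorem inner_sub_le_of_infDist_eq_add {X : Set E} {y z p : E} {T : ℝ} (hT : 0 < T)
    (hp : p ∈ X) (hyp : ‖y - p‖ = infDist y X) (hzy : ‖z - y‖ ≤ T)
    (hz : infDist y X + T ≤ infDist z X) {x : E} (hx : x ∈ X) :
    2 * T * ⟪y - p, x - p⟫_ℝ ≤ infDist y X * ‖x - p‖ ^ 2 := by
  set D := infDist y X with hD
  have hD0 : 0 ≤ D := infDist_nonneg
  have hzp : infDist z X ≤ ‖z - p‖ := by simpa [dist_eq_norm] using infDist_le_dist_of_mem hp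
  have htri : ‖z - p‖ ≤ ‖y - p‖ + ‖z - y‖ := by
    simpa [add_comm] using norm_add_le (y - p) (z - y)
  have e1 : ‖z - y‖ = T := by linarith
  have e2 : ‖z - p‖ = D + T := by linarith
  have hray : D • (z - y) = T • (y - p) := by
    have : SameRay ℝ (y - p) (z - y) := by
      rw [sameRay_iff_norm_add, show y - p + (z - y) = z - p by abel]
      linarith
    have := this.norm_smul_eq
    rwa [hyp, e1] at this
  have hR : D • (z - p) = (D + T) • (y - p) := by
    rw [add_smul, ← hray, ← smul_add]
    congr 1; abel
  have hzx := infDist_sq_le hx z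
  have hlow : (D + T) ^ 2 ≤ infDist z X ^ 2 := pow_le_pow_left₀ (by linarith) hz 2
  have hexp := norm_sub_sq_real (z - p) (x - p)
  rw [sub_sub_sub_cancel_right, e2] at hexp
  have h1 : 2 * ⟪z - p, x - p⟫_ℝ ≤ ‖x - p‖ ^ 2 := by linarith
  have h2 : D * ⟪z - p, x - p⟫_ℝ = (D + T) * ⟪y - p, x - p⟫_ℝ := by
    rw [← real_inner_smul_left, hR, real_inner_smul_left]
  have h3 : 2 * ((D + T) * ⟪y - p, x - p⟫_ℝ) ≤ D * ‖x - p‖ ^ 2 := by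
    rw [← h2]; nlinarith
  rcases le_total 0 ⟪y - p, x - p⟫_ℝ with h | h
  · nlinarith [mul_nonneg hD0 h]
  · have : 0 ≤ D * ‖x - p‖ ^ 2 := by positivity
    nlinarith

theorem norm_sub_le_two_mul_of_inner_le {y₁ y₂ p₁ p₂ : E}
    (h₁ : 4 * ⟪y₁ - p₁, p₂ - p₁⟫_ℝ ≤ ‖p₂ - p₁‖ ^ 2)
    (h₂ : 4 * ⟪y₂ - p₂, p₁ - p₂⟫_ℝ ≤ ‖p₁ - p₂‖ ^ 2) :
    ‖p₁ - p₂‖ ≤ 2 * ‖y₁ - y₂‖ := by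
  have hcs := real_inner_le_norm (y₁ - y₂) (p₁ - p₂)
  have e : ⟪y₁ - p₁, p₂ - p₁⟫_ℝ + ⟪y₂ - p₂, p₁ - p₂⟫_ℝ
      = ‖p₁ - p₂‖ ^ 2 - ⟪y₁ - y₂, p₁ - p₂⟫_ℝ := by
    rw [← real_inner_self_eq_norm_sq]
    simp only [inner_sub_left, inner_sub_right]
    ring
  rw [norm_sub_rev p₂ p₁] at h₁
  by_contra! hlt
  nlinarith [norm_nonneg (y₁ - y₂)]

end

/-- Around a local minimum `xbar` of (P), the projection onto `X`
is single-valued and Lipschitz on a ball `B(xbar, r_diff)`, and the Moreau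
envelope `w ↦ d(w)²/(2μ)` of the indicator of `X` is differentiable there with
gradient `(1/μ)(y − Π(y))`. -/
theorem nexos_projection_single_valued_and_envelope_differentiable
    {E : Type*} [NormedAddCommGroup E] [InnerProductSpace ℝ E] [FiniteDimensional ℝ E]
    (X : Set E) (hXne : X.Nonempty) (hXcl : IsClosed X)
    (f : E → ℝ) (f' : E → E) (α L β : ℝ)
    (hα : 0 < α) (hαL : α < L)
    (hsc : ConvexOn ℝ Set.univ (fun y => f y - α / 2 * ‖y‖ ^ 2))
    (hgrad : ∀ x, HasGradientAt f (f' x) x)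
    (hlip : ∀ x y, ‖f' x - f' y‖ ≤ L * ‖x - y‖)
    (hβ : 0 < β)
    -- Assumption 2
    (hassum2 : ∀ z : E, IsMinOn (fun y => f y + β / 2 * ‖y‖ ^ 2) Set.univ z → z ∉ X)
    -- `xbar` is a local minimum of (P)
    (xbar : E) (hxbarX : xbar ∈ X)
    (hproxreg : ∃ δ > 0, ∀ y : E, ‖y - xbar‖ < δ →
      ∃! p, p ∈ X ∧ ‖y - p‖ = Metric.infDist y X)
    (hlocmin : ∃ r > (0 : ℝ), ∀ y ∈ X ∩ Metric.closedBall xbar r, y ≠ xbar →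
      f xbar + β / 2 * ‖xbar‖ ^ 2 < f y + β / 2 * ‖y‖ ^ 2) :
    ∃ rdiff > (0 : ℝ), ∃ Ltilde ≥ (0 : ℝ), ∃ proj : E → E,
      -- (i) unique nearest point
      (∀ y ∈ Metric.ball xbar rdiff,
        proj y ∈ X ∧ ‖y - proj y‖ = Metric.infDist y X ∧
        (∀ p ∈ X, ‖y - p‖ = Metric.infDist y X → p = proj y)) ∧
      -- (ii) Lipschitz continuity of the projection
      (∀ y₁ ∈ Metric.ball xbar rdiff, ∀ y₂ ∈ Metric.ball xbar rdiff,
        ‖proj y₁ - proj y₂‖ ≤ Ltilde * ‖y₁ - y₂‖) ∧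
      -- (iii) differentiability of the Moreau envelope of the indicator
      (∀ μ : ℝ, 0 < μ → ∀ y ∈ Metric.ball xbar rdiff,
        HasGradientAt (fun w => (Metric.infDist w X) ^ 2 / (2 * μ))
          ((1 / μ) • (y - proj y)) y) := by
  obtain ⟨δ, hδ, huniq⟩ := hproxreg
  have hex : ∀ w : E, ∃ p ∈ X, ‖w - p‖ = infDist w X := fun w => by
    obtain ⟨p, hp, h⟩ := hXcl.exists_infDist_eq_dist hXne w
    exact ⟨p, hp, by rw [h, dist_eq_norm]⟩
  choose P hPX hP using hex
  have hPu : ∀ w ∈ ball xbar δ, ∀ p ∈ X, ‖w - p‖ = infDist w X → p = P w := by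
    intro w hw p hp hwp
    rw [mem_ball, dist_eq_norm] at hw
    exact (huniq w hw).unique ⟨hp, hwp⟩ ⟨hPX w, hP w⟩
  have hsub : ball xbar (δ / 4) ⊆ ball xbar δ := ball_subset_ball (by linarith)
  have hnormal : ∀ y ∈ ball xbar (δ / 4), ∀ x ∈ X,
      4 * inner ℝ (y - P y) (x - P y) ≤ ‖x - P y‖ ^ 2 := by
    intro y hy x hx
    have hd : infDist y X ≤ δ / 4 := (infDist_le_dist_of_mem hxbarX).trans (mem_ball.1 hy).le
    rcases (infDist_nonneg (x := y) (s := X)).eq_or_lt with h0 | hpos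
    · have : y - P y = 0 := norm_eq_zero.1 (by rw [hP, ← h0])
      rw [this, inner_zero_left, mul_zero]
      positivity
    · obtain ⟨z, hzy, hz⟩ := exists_infDist_eq_add hXcl hPX hP (T := δ / 2) (by positivity)
        (fun w hw => hPu w (by
          have := dist_triangle w y xbar
          rw [mem_ball] at *
          rw [mem_closedBall] at hw
          linarith)) hpos
      have := inner_sub_le_of_infDist_eq_add (by positivity) (hPX y) (hP y) hzy hz hx
      have h2 : δ * (4 * inner ℝ (y - P y) (x - P y)) ≤ δ * ‖x - P y‖ ^ 2 := by
        nlinarith [sq_nonneg ‖x - P y‖]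
      exact le_of_mul_le_mul_left h2 hδ
  refine ⟨δ / 4, by positivity, 2, by norm_num, P,
    fun y hy => ⟨hPX y, hP y, hPu y (hsub hy)⟩,
    fun y₁ h₁ y₂ h₂ => norm_sub_le_two_mul_of_inner_le
      (hnormal y₁ h₁ _ (hPX y₂)) (hnormal y₂ h₂ _ (hPX y₁)), fun μ hμ y hy => ?_⟩
  have hg := hasGradientAt_infDist_sq hPX hP
    (continuousAt_nearestPoint hXcl hPX hP (hPu y (hsub hy)))
  rw [hasGradientAt_iff_hasFDerivAt] at hg ⊢
  have := hg.const_mul (1 / (2 * μ))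
  have hfun : (fun w => infDist w X ^ 2 / (2 * μ)) = fun w => 1 / (2 * μ) * infDist w X ^ 2 := by
    ext w; ring
  have hvec : (1 / μ) • (y - P y) = (1 / (2 * μ)) • (2 : ℝ) • (y - P y) := by
    rw [smul_smul]
    congr 1
    field_simp
  rw [hfun, hvec, map_smul _ (1 / (2 * μ))]
  exact this
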